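/- For real t₁, t₂ and complex s with Re(s) > 0, ∫₀^∞ K_{it₁}(2πy) K_{it₂}(2πy) y^s dy/y = (π/8)·π^(−s−1)·Γ((s+it₁+it₂)/2)·Γ((s−it₁+it₂)/2)·Γ((s+it₁−it₂)/2)·Γ((s−it₁−it₂)/2)/Γ(s). -/

import Mathlib

open Complex Real MeasureTheory

/-- The modified Bessel function of the second kind (Macdonald function),
`K_ν(x) = ∫₀^∞ e^(−x cosh t) cosh(νt) dt`. -/
noncomputable def besselK (ν : ℂ) (x : ℝ) : ℂ :=
  ∫ t in Set.Ioi (0 : ℝ), Complex.exp (-(x : ℂ) * Real.cosh t) * Complex.cosh (ν * t)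

noncomputable def coshKer (s α : ℂ) (a : ℝ) : ℂ :=
  Complex.exp (α * a - s * (Real.log (Real.cosh a) : ℝ))

lemma log_sigmoid_two (a : ℝ) :
    Real.log (Real.sigmoid (2 * a)) = a - Real.log 2 - Real.log (Real.cosh a) := by
  have h : Real.sigmoid (2 * a) = Real.exp a / (2 * Real.cosh a) := by
    rw [Real.sigmoid_def, Real.cosh_eq]
    have : Real.exp (-(2 * a)) = Real.exp (-a) * Real.exp (-a) := by
      rw [← Real.exp_add]; ring_nf
    rw [this, Real.exp_neg]
    have := Real.exp_pos a
    field_simp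
  rw [h, Real.log_div (Real.exp_pos a).ne' (by have := Real.cosh_pos a; positivity), Real.log_exp,
    Real.log_mul (by norm_num) (Real.cosh_pos a).ne']
  ring

lemma coshKer_pt (s α : ℂ) (a : ℝ) :
    |Real.sigmoid (2 * a) * (1 - Real.sigmoid (2 * a)) * 2| •
      (((Real.sigmoid (2 * a) : ℝ) : ℂ) ^ ((s + α) / 2 - 1) *
        (1 - ((Real.sigmoid (2 * a) : ℝ) : ℂ)) ^ ((s - α) / 2 - 1)) =
      (2 : ℂ) ^ (1 - s) * coshKer s α a := by
  have h1 : 0 < Real.sigmoid (2 * a) := Real.sigmoid_pos _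
  have h2 : 0 < 1 - Real.sigmoid (2 * a) := sub_pos.2 (Real.sigmoid_lt_one _)
  have l1 := log_sigmoid_two a
  have l2 := log_sigmoid_two (-a)
  rw [mul_neg, Real.sigmoid_neg, Real.cosh_neg] at l2
  rw [abs_of_pos (by positivity)]
  set x := Real.sigmoid (2 * a)
  set y := 1 - x with hy
  have e1 : (1 - (x : ℂ)) = ((y : ℝ) : ℂ) := by rw [hy]; push_cast; ring
  have ex : (x : ℂ) = Complex.exp ((Real.log x : ℝ) : ℂ) := by
    rw [← Complex.ofReal_exp, Real.exp_log h1]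
  have ey : (y : ℂ) = Complex.exp ((Real.log y : ℝ) : ℂ) := by
    rw [← Complex.ofReal_exp, Real.exp_log h2]
  have e2 : (2 : ℂ) = Complex.exp ((Real.log 2 : ℝ) : ℂ) := by
    rw [← Complex.ofReal_exp, Real.exp_log (by norm_num)]; norm_num
  rw [e1, Complex.cpow_def_of_ne_zero (by exact_mod_cast h1.ne'),
    Complex.cpow_def_of_ne_zero (by exact_mod_cast h2.ne'),
    Complex.cpow_def_of_ne_zero (by norm_num), ← Complex.ofReal_log h1.le, ← Complex.ofReal_log h2.le,
    show Complex.log 2 = ((Real.log 2 : ℝ) : ℂ) by rw [Complex.ofReal_log (by norm_num)]; norm_num,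
    coshKer, Complex.real_smul]
  push_cast
  rw [show (x : ℂ) * y * 2 = Complex.exp ((Real.log x : ℝ) + (Real.log y : ℝ) + (Real.log 2 : ℝ)) by
    rw [Complex.exp_add, Complex.exp_add, ← ex, ← ey, ← e2]]
  rw [← Complex.exp_add, ← Complex.exp_add, ← Complex.exp_add, l1, l2]
  congr 1
  push_cast
  ring

lemma sig_image : (fun a : ℝ => Real.sigmoid (2 * a)) '' Set.univ = Set.Ioo 0 1 := by
  rw [Set.image_univ, ← Real.range_sigmoid]
  exact (show Function.Surjective (fun a : ℝ => 2 * a) from fun x => ⟨x / 2, by ring⟩).range_comp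
    Real.sigmoid

lemma sig_deriv (a : ℝ) : HasDerivWithinAt (fun a : ℝ => Real.sigmoid (2 * a))
    (Real.sigmoid (2 * a) * (1 - Real.sigmoid (2 * a)) * 2) Set.univ a := by
  have := (Real.hasDerivAt_sigmoid (2 * a)).comp a (by simpa using (hasDerivAt_id a).const_mul (2:ℝ))
  exact this.hasDerivWithinAt

lemma sig_inj : Set.InjOn (fun a : ℝ => Real.sigmoid (2 * a)) Set.univ := by
  intro a _ b _ h
  have := Real.sigmoid_injective h
  simpa using this

lemma coshKer_integrable {s α : ℂ} (hs : 0 < s.re) (hα : α.re = 0) :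
    Integrable (coshKer s α) := by
  have h := betaIntegral_convergent (u := (s + α) / 2) (v := (s - α) / 2)
    (by simp [hα, hs]) (by simp [hα, hs])
  rw [intervalIntegrable_iff_integrableOn_Ioo_of_le zero_le_one, ← sig_image,
    integrableOn_image_iff_integrableOn_abs_deriv_smul MeasurableSet.univ
      (fun a _ => sig_deriv a) sig_inj] at h
  simp only [coshKer_pt] at h
  rw [integrableOn_univ] at h
  have := h.const_mul (((2 : ℂ) ^ (1 - s))⁻¹)
  simpa [← mul_assoc, Complex.cpow_eq_zero_iff] using this

lemma coshKer_integral {s α : ℂ} (hs : 0 < s.re) (hα : α.re = 0) :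
    ∫ a, coshKer s α a = (2 : ℂ) ^ (s - 1) *
      (Complex.Gamma ((s + α) / 2) * Complex.Gamma ((s - α) / 2)) / Complex.Gamma s := by
  have h := Gamma_mul_Gamma_eq_betaIntegral (s := (s + α) / 2) (t := (s - α) / 2)
    (by simp [hα, hs]) (by simp [hα, hs])
  have hb : betaIntegral ((s + α) / 2) ((s - α) / 2) = (2 : ℂ) ^ (1 - s) * ∫ a, coshKer s α a := by
    rw [betaIntegral, intervalIntegral.integral_of_le zero_le_one, integral_Ioc_eq_integral_Ioo,
      ← sig_image, integral_image_eq_integral_abs_deriv_smul MeasurableSet.univ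
      (fun a _ => sig_deriv a) sig_inj]
    simp only [coshKer_pt]
    rw [setIntegral_univ, integral_const_mul]
  rw [h, hb, show (s + α) / 2 + (s - α) / 2 = s by ring]
  have : Complex.Gamma s ≠ 0 := Complex.Gamma_ne_zero_of_re_pos hs
  have h2 : (2 : ℂ) ^ (s - 1) * (2 : ℂ) ^ (1 - s) = 1 := by
    rw [← Complex.cpow_add _ _ (by norm_num)]; simp
  field_simp
  linear_combination (-∫ a, coshKer s α a) * h2

lemma exp_cosh_integrable {x : ℝ} (hx : 0 < x) (τ : ℝ) :
    Integrable (fun t : ℝ => Complex.exp (-(x : ℂ) * Real.cosh t) * Complex.exp (I * τ * t)) := by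
  refine (integrable_exp_neg_mul_sq (b := x / 2) (by positivity)).mono'
    (by fun_prop) (Filter.Eventually.of_forall fun t => ?_)
  rw [norm_mul, Complex.norm_exp, Complex.norm_exp]
  have : t ^ 2 / 2 ≤ Real.cosh t := by
    rw [← Real.cosh_abs]
    have h1 := Real.quadratic_le_exp_of_nonneg (abs_nonneg t)
    have h2 := Real.exp_pos (-|t|)
    rw [Real.cosh_eq]
    have h3 := Real.add_one_le_exp (-|t|)
    have h4 := Real.sum_le_exp_of_nonneg (abs_nonneg t) 4
    simp [Finset.sum_range_succ, Nat.factorial] at h4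
    nlinarith [sq_abs t, abs_nonneg t]
  have h0 : (I * (τ : ℂ) * (t : ℂ)).re = 0 := by simp
  have h1 : (-(x : ℂ) * (Real.cosh t : ℝ)).re = -x * Real.cosh t := by
    rw [← Complex.ofReal_neg, ← Complex.ofReal_mul, Complex.ofReal_re]
  rw [h0, h1, Real.exp_zero, mul_one]
  apply Real.exp_le_exp.2
  nlinarith

lemma besselK_eq {x : ℝ} (hx : 0 < x) (τ : ℝ) : besselK (I * τ) x =
    1 / 2 * ∫ t : ℝ, Complex.exp (-(x : ℂ) * Real.cosh t) * Complex.exp (I * τ * t) := by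
  have hi := exp_cosh_integrable hx τ
  rw [← integral_add_compl (measurableSet_Ioi (a := (0 : ℝ))) hi, Set.compl_Ioi]
  have := integral_comp_neg_Ioi (0 : ℝ)
    (fun t : ℝ => Complex.exp (-(x : ℂ) * Real.cosh t) * Complex.exp (I * τ * t))
  rw [neg_zero] at this
  rw [← this, ← integral_add hi.integrableOn, besselK, ← integral_const_mul]
  · refine integral_congr_ae (Filter.Eventually.of_forall fun t => ?_)
    simp only [Real.cosh_neg, Complex.cosh]
    push_cast
    ring_nf
  · exact (hi.comp_neg).integrableOn

/-- The linear change of variables `(a, b) ↦ (a + b, a - b)`. -/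
noncomputable def rotL : ℝ × ℝ →L[ℝ] ℝ × ℝ :=
  LinearMap.toContinuousLinearMap (Matrix.toLin (Module.Basis.finTwoProd ℝ) (Module.Basis.finTwoProd ℝ)
    !![1, 1; 1, -1])

lemma rotL_apply (p : ℝ × ℝ) : rotL p = (p.1 + p.2, p.1 - p.2) := by
  simp [rotL, Matrix.toLin_finTwoProd_toContinuousLinearMap, sub_eq_add_neg]

lemma rotL_det : rotL.det = -2 := by
  simp only [rotL, LinearMap.det_toContinuousLinearMap, LinearMap.det_toLin, Matrix.det_fin_two_of]
  norm_num

lemma integral_rot (g : ℝ × ℝ → ℂ) :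
    ∫ p, g p = 2 * ∫ p : ℝ × ℝ, g (p.1 + p.2, p.1 - p.2) := by
  have hinj : Function.Injective rotL := by
    intro p q h
    rw [rotL_apply, rotL_apply, Prod.mk.injEq] at h
    exact Prod.ext (by linarith [h.1, h.2]) (by linarith [h.1, h.2])
  have hsurj : Function.Surjective rotL := fun p =>
    ⟨((p.1 + p.2) / 2, (p.1 - p.2) / 2), by rw [rotL_apply]; ext <;> simp <;> ring⟩
  have := integral_image_eq_integral_abs_det_fderiv_smul (volume : Measure (ℝ × ℝ))
    MeasurableSet.univ (fun x _ => rotL.hasFDerivWithinAt (x := x) (s := Set.univ))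
    hinj.injOn g
  rw [Set.image_univ, hsurj.range_eq, setIntegral_univ, setIntegral_univ, rotL_det] at this
  rw [this, integral_smul, Complex.real_smul]
  simp [rotL_apply]

noncomputable def tripleKer (s : ℂ) (α β : ℝ) (y : ℝ) (p : ℝ × ℝ) : ℂ :=
  (y : ℂ) ^ (s - 1) * Complex.exp (-(((4 * π * Real.cosh p.1 * Real.cosh p.2 : ℝ) : ℂ) * y)) *
    (Complex.exp (I * α * p.1) * Complex.exp (I * β * p.2))

lemma norm_exp_I (α a : ℝ) : ‖Complex.exp (I * α * a)‖ = 1 := by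
  rw [Complex.norm_exp]; simp

lemma coef_pos (p : ℝ × ℝ) : 0 < 4 * π * Real.cosh p.1 * Real.cosh p.2 := by
  have := Real.cosh_pos p.1
  have := Real.cosh_pos p.2
  have := Real.pi_pos
  positivity

lemma coef_cpow (s : ℂ) (p : ℝ × ℝ) :
    (1 / ((4 * π * Real.cosh p.1 * Real.cosh p.2 : ℝ) : ℂ)) ^ s =
      ((4 * π : ℝ) : ℂ) ^ (-s) * (coshKer s 0 p.1 * coshKer s 0 p.2) := by
  have h1 := Real.cosh_pos p.1
  have h2 := Real.cosh_pos p.2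
  have h3 := Real.pi_pos
  have h := coef_pos p
  rw [← Complex.ofReal_one, ← Complex.ofReal_div,
    Complex.cpow_def_of_ne_zero (by exact_mod_cast (one_div_pos.2 h).ne'),
    Complex.cpow_def_of_ne_zero (by exact_mod_cast (by positivity : (4 * π) ≠ 0)),
    ← Complex.ofReal_log (by positivity), ← Complex.ofReal_log (by positivity), one_div, Real.log_inv,
    Real.log_mul (by positivity) h2.ne', Real.log_mul (by positivity) h1.ne', coshKer, coshKer,
    ← Complex.exp_add, ← Complex.exp_add]
  congr 1
  push_cast
  ring

lemma coshKer_zero (s : ℂ) (α : ℝ) (a : ℝ) :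
    coshKer s 0 a * Complex.exp (I * α * a) = coshKer s (I * α) a := by
  rw [coshKer, coshKer, ← Complex.exp_add]
  congr 1
  ring

lemma tripleKer_norm (s : ℂ) (α β : ℝ) {y : ℝ} (hy : 0 < y) (p : ℝ × ℝ) :
    ‖tripleKer s α β y p‖ =
      y ^ (s.re - 1) * Real.exp (-((4 * π * Real.cosh p.1 * Real.cosh p.2) * y)) := by
  rw [tripleKer, norm_mul, norm_mul, norm_mul, norm_exp_I, norm_exp_I, mul_one, mul_one,
    Complex.norm_cpow_eq_rpow_re_of_pos hy, ← Complex.ofReal_mul, ← Complex.ofReal_neg,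
    Complex.norm_exp_ofReal]
  simp

lemma tripleKer_integrable {s : ℂ} (hs : 0 < s.re) (α β : ℝ) :
    Integrable (Function.uncurry (tripleKer s α β))
      ((volume.restrict (Set.Ioi (0 : ℝ))).prod (volume : Measure (ℝ × ℝ))) := by
  have hm : AEStronglyMeasurable (Function.uncurry (tripleKer s α β))
      ((volume.restrict (Set.Ioi (0 : ℝ))).prod (volume : Measure (ℝ × ℝ))) := by
    apply Measurable.aestronglyMeasurable
    unfold Function.uncurry tripleKer
    fun_prop
  rw [integrable_prod_iff' hm]
  constructor
  · refine Filter.Eventually.of_forall fun p => ?_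
    have h := integrableOn_rpow_mul_exp_neg_mul_rpow (p := 1) (s := s.re - 1) (by linarith) one_pos
      (coef_pos p)
    refine Integrable.mono' h ?_ ?_
    · apply Measurable.aestronglyMeasurable
      unfold Function.uncurry tripleKer
      fun_prop
    · refine (ae_restrict_iff' measurableSet_Ioi).2 (Filter.Eventually.of_forall fun y hy => ?_)
      rw [Function.uncurry, tripleKer_norm _ _ _ hy]
      simp
  · have h1 : ∀ p : ℝ × ℝ, ∫ y in Set.Ioi (0 : ℝ), ‖Function.uncurry (tripleKer s α β) (y, p)‖ =
        (4 * π) ^ (-s.re) * Real.Gamma s.re * (‖coshKer s 0 p.1‖ * ‖coshKer s 0 p.2‖) := by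
      intro p
      rw [setIntegral_congr_fun measurableSet_Ioi
        (fun y hy => by rw [Function.uncurry, tripleKer_norm _ _ _ hy]),
        Real.integral_rpow_mul_exp_neg_mul_Ioi hs (coef_pos p)]
      have := congrArg norm (coef_cpow s p)
      rw [norm_mul, norm_mul, ← Complex.ofReal_one, ← Complex.ofReal_div,
        Complex.norm_cpow_eq_rpow_re_of_pos (one_div_pos.2 (coef_pos p)),
        Complex.norm_cpow_eq_rpow_re_of_pos (by have := Real.pi_pos; positivity),
        Complex.neg_re] at this
      rw [this]
      ring
    simp only [h1]
    have hc := (coshKer_integrable (α := 0) hs rfl).norm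
    exact (hc.mul_prod hc).const_mul _

lemma tripleKer_integral {s : ℂ} (hs : 0 < s.re) (α β : ℝ) :
    ∫ y in Set.Ioi (0 : ℝ), ∫ p, tripleKer s α β y p =
      ((4 * π : ℝ) : ℂ) ^ (-s) * Complex.Gamma s *
        ((∫ a, coshKer s (I * α) a) * ∫ b, coshKer s (I * β) b) := by
  rw [integral_integral_swap (tripleKer_integrable hs α β), ← integral_prod_mul,
    ← integral_const_mul]
  refine integral_congr_ae (Filter.Eventually.of_forall fun p => ?_)
  simp only [tripleKer]
  rw [integral_mul_const, Complex.integral_cpow_mul_exp_neg_mul_Ioi hs, coef_cpow,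
    ← coshKer_zero, ← coshKer_zero]
  · ring
  · simpa only [Complex.ofReal_re] using coef_pos p

/-- Mellin transform of a product of two K-Bessel functions (Bateman 6.8.48):
∫₀^∞ K_{it₁}(2πy) K_{it₂}(2πy) y^s dy/y
  = (π/8)·π^(−s−1)·Γ((s+it₁+it₂)/2)Γ((s−it₁+it₂)/2)Γ((s+it₁−it₂)/2)Γ((s−it₁−it₂)/2)/Γ(s). -/
theorem besselK_mellin_product (t₁ t₂ : ℝ) (s : ℂ) (hs : 0 < s.re) :
    ∫ y in Set.Ioi (0 : ℝ),
        besselK (Complex.I * t₁) (2 * π * y) * besselK (Complex.I * t₂) (2 * π * y)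
          * (y : ℂ) ^ (s - 1)
      = ((π : ℂ) / 8) * (π : ℂ) ^ (-s - 1) *
          (Complex.Gamma ((s + Complex.I * t₁ + Complex.I * t₂) / 2) *
           Complex.Gamma ((s - Complex.I * t₁ + Complex.I * t₂) / 2) *
           Complex.Gamma ((s + Complex.I * t₁ - Complex.I * t₂) / 2) *
           Complex.Gamma ((s - Complex.I * t₁ - Complex.I * t₂) / 2)) / Complex.Gamma s := by
  have key : ∀ y ∈ Set.Ioi (0 : ℝ),
      besselK (Complex.I * t₁) (2 * π * y) * besselK (Complex.I * t₂) (2 * π * y)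
          * (y : ℂ) ^ (s - 1) = 1 / 2 * ∫ p, tripleKer s (t₁ + t₂) (t₁ - t₂) y p := by
    intro y hy
    have hy' : 0 < 2 * π * y := by
      have := Real.pi_pos
      have : 0 < y := hy
      positivity
    rw [besselK_eq hy', besselK_eq hy', mul_mul_mul_comm, ← integral_prod_mul]
    change _ * (∫ p : ℝ × ℝ, _) * _ = _
    rw [integral_rot, mul_assoc, mul_assoc, mul_assoc, ← integral_mul_const, ← integral_const_mul,
      ← integral_const_mul, ← integral_const_mul, ← integral_const_mul]
    refine integral_congr_ae (Filter.Eventually.of_forall fun p => ?_)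
    simp only [tripleKer]
    have e : Complex.exp (-((2 * π * y : ℝ) : ℂ) * Real.cosh (p.1 + p.2)) *
          Complex.exp (I * t₁ * ((p.1 + p.2 : ℝ) : ℂ)) *
        (Complex.exp (-((2 * π * y : ℝ) : ℂ) * Real.cosh (p.1 - p.2)) *
          Complex.exp (I * t₂ * ((p.1 - p.2 : ℝ) : ℂ))) =
        Complex.exp (-(((4 * π * Real.cosh p.1 * Real.cosh p.2 : ℝ) : ℂ) * y)) *
    (Complex.exp (I * (t₁ + t₂ : ℝ) * p.1) * Complex.exp (I * (t₁ - t₂ : ℝ) * p.2)) := by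
      rw [Real.cosh_add, Real.cosh_sub]
      simp only [← Complex.exp_add]
      congr 1
      push_cast
      ring
    rw [e]
    ring
  rw [setIntegral_congr_fun measurableSet_Ioi key, integral_const_mul, tripleKer_integral hs,
    coshKer_integral hs (by simp), coshKer_integral hs (by simp)]
  have hG : Complex.Gamma s ≠ 0 := Complex.Gamma_ne_zero_of_re_pos hs
  have hpi : (π : ℂ) ≠ 0 := by exact_mod_cast Real.pi_ne_zero
  have hp : ((4 * π : ℝ) : ℂ) ^ (-s) * ((2 : ℂ) ^ (s - 1) * (2 : ℂ) ^ (s - 1)) =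
      (π : ℂ) * (π : ℂ) ^ (-s - 1) / 4 := by
    have h4 : ((4 * π : ℝ) : ℂ) ^ (-s) = (2 : ℂ) ^ (-s) * (2 : ℂ) ^ (-s) * (π : ℂ) ^ (-s) := by
      rw [show (4 * π : ℝ) = 2 * (2 * π) by ring, Complex.ofReal_mul,
        Complex.mul_cpow_ofReal_nonneg (by norm_num) (by have := Real.pi_pos; positivity),
        Complex.ofReal_mul,
        Complex.mul_cpow_ofReal_nonneg (by norm_num) Real.pi_pos.le]
      push_cast
      ring
    have h2 : (2 : ℂ) ^ (-s) * (2 : ℂ) ^ (s - 1) = 1 / 2 := by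
      rw [← Complex.cpow_add _ _ (by norm_num), show -s + (s - 1) = -1 by ring,
        Complex.cpow_neg_one]
      norm_num
    rw [h4, Complex.cpow_sub _ _ hpi, Complex.cpow_one]
    field_simp
    linear_combination (4 * (2 : ℂ) ^ (-s) * (2 : ℂ) ^ (s - 1) + 2) * h2
  rw [show (s + I * ((t₁ + t₂ : ℝ) : ℂ)) / 2 = (s + I * t₁ + I * t₂) / 2 by push_cast; ring,
    show (s - I * ((t₁ + t₂ : ℝ) : ℂ)) / 2 = (s - I * t₁ - I * t₂) / 2 by push_cast; ring,
    show (s + I * ((t₁ - t₂ : ℝ) : ℂ)) / 2 = (s + I * t₁ - I * t₂) / 2 by push_cast; ring,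
    show (s - I * ((t₁ - t₂ : ℝ) : ℂ)) / 2 = (s - I * t₁ + I * t₂) / 2 by push_cast; ring]
  generalize Complex.Gamma ((s + I * t₁ + I * t₂) / 2) = A
  generalize Complex.Gamma ((s - I * t₁ - I * t₂) / 2) = B
  generalize Complex.Gamma ((s + I * t₁ - I * t₂) / 2) = C
  generalize Complex.Gamma ((s - I * t₁ + I * t₂) / 2) = D
  generalize Complex.Gamma s = G at *
  calc _ = 1 / 2 * (((4 * π : ℝ) : ℂ) ^ (-s) * ((2 : ℂ) ^ (s - 1) * (2 : ℂ) ^ (s - 1))) *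
        (A * B * C * D) / G := by
        field_simp
    _ = _ := by rw [hp]; ring
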